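/- If $\psi$ is bounded on $[1,\infty)$ (equivalently $\psi\asymp 1$ there, since $\psi$ is non-decreasing with $\psi(1)>0$), then $QA_{\varphi,\psi}=\Lambda_\varphi$: there exists a constant $K>0$ such that $K^{-1}\,\|f\|_{\Lambda_\varphi}\le\|f\|_{\varphi,\psi}\le K\,\|f\|_{\Lambda_\varphi}$ for every measurable function $f$ on $[0,1]$. -/

import Mathlib

open MeasureTheory ENNReal Set Filter Topology

noncomputable section

/-- Lebesgue measure restricted to the interval `[0,1]`. -/
def μ01 : Measure ℝ := volume.restrict (Set.Icc 0 1)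

/-- `φ : [0,1] → [0,∞)` is concave, non-decreasing, and vanishes only at the origin. -/
structure IsPhi (φ : ℝ → ℝ) : Prop where
  concave : ConcaveOn ℝ (Set.Icc 0 1) φ
  mono : MonotoneOn φ (Set.Icc 0 1)
  zero : φ 0 = 0
  pos : ∀ t : ℝ, 0 < t → t ≤ 1 → 0 < φ t

/-- `ψ : [0,∞) → [0,∞)` is concave, non-decreasing, and vanishes only at the origin. -/
structure IsPsi (ψ : ℝ → ℝ) : Prop where
  concave : ConcaveOn ℝ (Set.Ici 0) ψ
  mono : MonotoneOn ψ (Set.Ici 0)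
  zero : ψ 0 = 0
  pos : ∀ t : ℝ, 0 < t → 0 < ψ t

/-- A sequence `g` of nonnegative `L^∞` functions with `|f| ≤ ∑ₙ gₙ` a.e. -/
def Admissible (f : ℝ → ℝ) (g : ℕ → ℝ → ℝ) : Prop :=
  (∀ n, AEMeasurable (g n) μ01) ∧
  (∀ n, eLpNorm (g n) ⊤ μ01 < ⊤) ∧
  (∀ n x, 0 ≤ g n x) ∧
  (∀ᵐ x ∂μ01, ENNReal.ofReal |f x| ≤ ∑' n : ℕ, ENNReal.ofReal (g n x))

/-- The cost `∑ₙ ψ(n) ‖gₙ‖_∞ φ(‖gₙ‖₁/‖gₙ‖_∞)` of a decomposition (index shifted by 1;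
`0/0 = 0` by the `ℝ≥0∞` division convention, and `φ 0 = 0`). -/
def seqCost (φ ψ : ℝ → ℝ) (g : ℕ → ℝ → ℝ) : ℝ≥0∞ :=
  ∑' n : ℕ, ENNReal.ofReal
    (ψ ((n : ℝ) + 1) * (eLpNorm (g n) ⊤ μ01).toReal *
      φ ((eLpNorm (g n) 1 μ01 / eLpNorm (g n) ⊤ μ01).toReal))

/-- The quasi-norm `‖f‖_{φ,ψ}` (equal to `∞` when no admissible decomposition exists). -/
def QANorm (φ ψ : ℝ → ℝ) (f : ℝ → ℝ) : ℝ≥0∞ :=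
  ⨅ (g : ℕ → ℝ → ℝ) (_ : Admissible f g), seqCost φ ψ g

/-- Membership in the space `QA_{φ,ψ}`. -/
def MemQA (φ ψ : ℝ → ℝ) (f : ℝ → ℝ) : Prop :=
  AEMeasurable f μ01 ∧ QANorm φ ψ f < ⊤

/-- The decreasing rearrangement `f*` of `f` on `[0,1]`. -/
def decRearr (f : ℝ → ℝ) (t : ℝ) : ℝ :=
  sInf {s : ℝ | 0 ≤ s ∧ μ01 {x | s < |f x|} ≤ ENNReal.ofReal t}

/-- The limit `ζ(0⁺)` of a non-decreasing function `ζ` on `[0,1]`. -/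
def limZero (ζ : ℝ → ℝ) : ℝ := sInf (ζ '' Set.Ioc 0 1)

/-- The Lorentz norm `‖f‖_{Λ_ζ} = ∫₀¹ f* dζ = ‖f‖_∞ ζ(0⁺) + ∫₀¹ f*(s) ζ'(s) ds`
(for `ζ` concave the derivative exists a.e. and `ζ` is absolutely continuous on `(0,1]`). -/
def lorentzNorm (ζ : ℝ → ℝ) (f : ℝ → ℝ) : ℝ≥0∞ :=
  eLpNorm f ⊤ μ01 * ENNReal.ofReal (limZero ζ) +
    ∫⁻ s in Set.Ioc (0:ℝ) 1, ENNReal.ofReal (decRearr f s * deriv ζ s)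

/-- Membership in the Lorentz space `Λ_ζ`. -/
def MemLorentz (ζ : ℝ → ℝ) (f : ℝ → ℝ) : Prop :=
  AEMeasurable f μ01 ∧ lorentzNorm ζ f < ⊤

/-- The quasi-concave function `φ_s(t) = inf_n max{sₙ,t} (φ(sₙ)/sₙ) ψ(n)` (index shifted by 1). -/
def phiSeq (φ ψ : ℝ → ℝ) (s : ℕ → ℝ) (t : ℝ) : ℝ :=
  if t = 0 then 0 else ⨅ n : ℕ, max (s n) t * (φ (s n) / s n) * ψ ((n : ℝ) + 1)

/-- The function `τ(t) = φ(t) ψ(logbar(φ(t)/t))` with `logbar t = 1 + log⁺ t`. -/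
def tauF (φ ψ : ℝ → ℝ) (t : ℝ) : ℝ :=
  if t = 0 then 0 else φ t * ψ (1 + max (Real.log (φ t / t)) 0)

theorem phi_contOn {φ : ℝ → ℝ} (hφ : IsPhi φ) (hφ0 : Tendsto φ (𝓝[>] 0) (𝓝 0)) :
    ContinuousOn φ (Icc 0 1) := by
  intro x hx
  rcases eq_or_lt_of_le hx.1 with h0 | h0
  · subst h0
    have h1 : ContinuousWithinAt φ (Ioi 0) 0 := by
      unfold ContinuousWithinAt; rw [hφ.zero]; exact hφ0
    exact (continuousWithinAt_Ioi_iff_Ici.1 h1).mono Icc_subset_Ici_self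
  rcases eq_or_lt_of_le hx.2 with h1 | h1
  · subst h1
    have hl : Tendsto (fun t : ℝ => t * φ 1) (𝓝[Icc 0 1] 1) (𝓝 (φ 1)) := by
      have : Tendsto (fun t : ℝ => t * φ 1) (𝓝 1) (𝓝 (1 * φ 1)) :=
        (continuous_id.mul continuous_const).tendsto 1
      rw [one_mul] at this
      exact this.mono_left nhdsWithin_le_nhds
    refine tendsto_of_tendsto_of_tendsto_of_le_of_le' hl tendsto_const_nhds ?_ ?_
    · filter_upwards [self_mem_nhdsWithin] with t ht
      have := hφ.concave.2 (show (1:ℝ) ∈ Icc (0:ℝ) 1 by simp) (show (0:ℝ) ∈ Icc (0:ℝ) 1 by simp) (show 0 ≤ t from ht.1)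
        (show 0 ≤ 1 - t by linarith [ht.2]) (by ring)
      simpa [hφ.zero] using this
    · filter_upwards [self_mem_nhdsWithin] with t ht
      exact hφ.mono ht hx ht.2
  · have h := hφ.concave.continuousOn_interior x (by rw [interior_Icc]; exact ⟨h0, h1⟩)
    rw [interior_Icc, continuousWithinAt_iff_continuousAt (Ioo_mem_nhds h0 h1)] at h
    exact h.continuousWithinAt

theorem phi_ae_diff {φ : ℝ → ℝ} (hφ : IsPhi φ) :
    ∀ᵐ x : ℝ, x ∈ Ioc (0:ℝ) 1 → (x ∈ Ioo (0:ℝ) 1 ∧ DifferentiableAt ℝ φ x) := by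
  have h1 := hφ.mono.ae_differentiableWithinAt_of_mem
  have h2 : ∀ᵐ x : ℝ, x ≠ 1 := by simp [ae_iff]
  filter_upwards [h1, h2] with x hx hx1 hm
  have hm' : x ∈ Ioo (0:ℝ) 1 := ⟨hm.1, lt_of_le_of_ne hm.2 hx1⟩
  exact ⟨hm', (hx (Ioo_subset_Icc_self hm')).differentiableAt (Icc_mem_nhds hm'.1 hm'.2)⟩

theorem phi_deriv_nonneg {φ : ℝ → ℝ} (hφ : IsPhi φ) {x : ℝ} (hx : x ∈ Ioo (0:ℝ) 1) :
    0 ≤ deriv φ x := by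
  by_cases hd : DifferentiableAt ℝ φ x
  · have := (hφ.mono.derivWithin_nonneg : 0 ≤ derivWithin φ (Icc 0 1) x)
    rwa [derivWithin_of_mem_nhds (Icc_mem_nhds hx.1 hx.2)] at this
  · rw [deriv_zero_of_not_differentiableAt hd]

theorem phi_deriv_anti {φ : ℝ → ℝ} (hφ : IsPhi φ) {x y : ℝ} (hx : x ∈ Ioo (0:ℝ) 1)
    (hy : y ∈ Ioo (0:ℝ) 1) (hxy : x < y) (dx : DifferentiableAt ℝ φ x)
    (dy : DifferentiableAt ℝ φ y) : deriv φ y ≤ deriv φ x :=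
  (hφ.concave.deriv_le_slope (Ioo_subset_Icc_self hx) (Ioo_subset_Icc_self hy) hxy dy).trans
    (hφ.concave.slope_le_deriv (Ioo_subset_Icc_self hx) (Ioo_subset_Icc_self hy) hxy dx)

theorem phi_lintegral {φ : ℝ → ℝ} (hφ : IsPhi φ) (hφ0 : Tendsto φ (𝓝[>] 0) (𝓝 0)) {r : ℝ}
    (hr : r ∈ Icc (0:ℝ) 1) :
    ∫⁻ s in Ioc 0 r, ENNReal.ofReal (deriv φ s) = ENNReal.ofReal (φ r) := by
  have hsub : Icc 0 r ⊆ Icc (0:ℝ) 1 := Icc_subset_Icc_right hr.2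
  have hii : IntervalIntegrable (deriv φ) volume 0 r :=
    MonotoneOn.intervalIntegrable_deriv (by rw [uIcc_of_le hr.1]; exact hφ.mono.mono hsub)
  have hio : IntegrableOn (deriv φ) (Ioc 0 r) := hii.1
  have hae : ∀ᵐ x ∂(volume.restrict (Ioc 0 r)), x ∈ Ioo (0:ℝ) 1 ∧ DifferentiableAt ℝ φ x := by
    rw [ae_restrict_iff' measurableSet_Ioc]
    filter_upwards [phi_ae_diff hφ] with x hx hm
    exact hx ⟨hm.1, hm.2.trans hr.2⟩
  have heq : (fun x => derivWithin φ (Ioi x) x) =ᵐ[volume.restrict (Ioc 0 r)] deriv φ := by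
    filter_upwards [hae] with x hx
    exact hx.2.hasDerivAt.hasDerivWithinAt.derivWithin (uniqueDiffWithinAt_Ioi x)
  have hint : ∫ y in (0:ℝ)..r, derivWithin φ (Ioi y) y = φ r - φ 0 := by
    apply intervalIntegral.integral_eq_sub_of_hasDeriv_right_of_le hr.1
      ((phi_contOn hφ hφ0).mono hsub)
    · intro x hx
      have hc : ConvexOn ℝ (Icc 0 1) (-φ) := hφ.concave.neg
      have := hc.differentiableWithinAt_Ioi_of_mem_interior (x := x)
        (by rw [interior_Icc]; exact ⟨hx.1, hx.2.trans_le hr.2⟩)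
      have h2 := this.neg
      rw [neg_neg] at h2
      exact h2.hasDerivWithinAt
    · rw [intervalIntegrable_iff_integrableOn_Ioc_of_le hr.1]
      exact hio.congr heq.symm
  rw [← ofReal_integral_eq_lintegral_ofReal hio (by
    filter_upwards [hae] with x hx using phi_deriv_nonneg hφ hx.1)]
  rw [intervalIntegral.integral_of_le hr.1, integral_congr_ae heq, hφ.zero, sub_zero] at hint
  rw [hint]

theorem phi_level {φ : ℝ → ℝ} (hφ : IsPhi φ) (u : ℝ) :
    ∃ a ∈ Icc (0:ℝ) 1, ({s | u < deriv φ s} ∩ Ioc 0 1 : Set ℝ) =ᵐ[volume] Ioc 0 a := by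
  set A : Set ℝ := {s | s ∈ Ioo (0:ℝ) 1 ∧ DifferentiableAt ℝ φ s ∧ u < deriv φ s} with hA
  have hbdd : BddAbove (insert 0 A) := ⟨1, by
    rintro x (rfl | hx)
    · simp
    · exact hx.1.2.le⟩
  have h0 : 0 ≤ sSup (insert 0 A) := le_csSup hbdd (mem_insert _ _)
  refine ⟨sSup (insert 0 A), ⟨h0, ?_⟩, ?_⟩
  · apply csSup_le (insert_nonempty _ _)
    rintro x (rfl | hx)
    · simp
    · exact hx.1.2.le
  have h2 : ∀ᵐ x : ℝ, x ≠ sSup (insert 0 A) := by simp [ae_iff]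
  filter_upwards [phi_ae_diff hφ, h2] with x hx hx2
  apply propext
  change (u < deriv φ x ∧ x ∈ Ioc (0:ℝ) 1) ↔ x ∈ Ioc 0 (sSup (insert 0 A))
  constructor
  · rintro ⟨h, hm⟩
    exact ⟨hm.1, le_csSup hbdd (mem_insert_of_mem _ ⟨(hx hm).1, (hx hm).2, h⟩)⟩
  · rintro ⟨h, hm⟩
    obtain ⟨y, hy, hxy⟩ := exists_lt_of_lt_csSup (insert_nonempty _ _) (lt_of_le_of_ne hm hx2)
    rcases hy with rfl | hy
    · exact absurd hxy (not_lt.2 h.le)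
    have hm : x ∈ Ioc (0:ℝ) 1 := ⟨h, (hxy.trans hy.1.2).le⟩
    exact ⟨hy.2.2.trans_le (phi_deriv_anti hφ (hx hm).1 hy.1 hxy (hx hm).2 hy.2.1), hm⟩

theorem limZero_eq {φ : ℝ → ℝ} (hφ : IsPhi φ) (hφ0 : Tendsto φ (𝓝[>] 0) (𝓝 0)) :
    ENNReal.ofReal (limZero φ) = 0 := by
  rw [ENNReal.ofReal_eq_zero]
  apply ge_of_tendsto hφ0
  filter_upwards [Ioc_mem_nhdsGT (zero_lt_one' ℝ)] with t ht
  exact csInf_le ⟨0, by rintro _ ⟨x, hx, rfl⟩; exact (hφ.pos x hx.1 hx.2).le⟩ ⟨t, ht, rfl⟩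

theorem lorentz_eq {φ : ℝ → ℝ} (hφ : IsPhi φ) (hφ0 : Tendsto φ (𝓝[>] 0) (𝓝 0)) (f : ℝ → ℝ) :
    lorentzNorm φ f = ∫⁻ s in Set.Ioc (0:ℝ) 1,
      ENNReal.ofReal (decRearr f s) * ENNReal.ofReal (deriv φ s) := by
  unfold lorentzNorm
  rw [limZero_eq hφ hφ0, mul_zero, zero_add]
  congr 1
  ext s
  exact ENNReal.ofReal_mul (Real.sInf_nonneg fun x hx => hx.1)

instance : IsProbabilityMeasure μ01 := ⟨by simp [μ01]⟩

theorem rearr_nonempty {f : ℝ → ℝ} (hf : AEMeasurable f μ01) {t : ℝ} (ht : 0 < t) :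
    {s : ℝ | 0 ≤ s ∧ μ01 {x | s < |f x|} ≤ ENNReal.ofReal t}.Nonempty := by
  have h := tendsto_measure_iInter_atTop (μ := μ01) (s := fun n : ℕ => {x | (n:ℝ) < |f x|})
    (fun n => nullMeasurableSet_lt aemeasurable_const hf.abs)
    (fun m n hmn x (hx : (n:ℝ) < |f x|) =>
      show (m:ℝ) < |f x| from lt_of_le_of_lt (Nat.cast_le.2 hmn) hx) ⟨0, measure_ne_top _ _⟩
  have he : (⋂ n : ℕ, {x | (n:ℝ) < |f x|}) = ∅ := by
    rw [eq_empty_iff_forall_notMem]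
    intro x hx
    obtain ⟨n, hn⟩ := exists_nat_gt |f x|
    exact absurd (mem_iInter.1 hx n) (not_lt.2 hn.le)
  rw [he, measure_empty] at h
  obtain ⟨n, hn⟩ := (h.eventually_le_const (ENNReal.ofReal_pos.2 ht)).exists
  exact ⟨n, Nat.cast_nonneg n, hn⟩

theorem decRearr_nonneg (f : ℝ → ℝ) (t : ℝ) : 0 ≤ decRearr f t :=
  Real.sInf_nonneg fun _ hx => hx.1

theorem decRearr_anti {f : ℝ → ℝ} (hf : AEMeasurable f μ01) :
    AntitoneOn (decRearr f) (Ioc 0 1) := by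
  intro x hx y _ hxy
  refine csInf_le_csInf ⟨0, fun _ hx => hx.1⟩ (rearr_nonempty hf hx.1) ?_
  exact fun s hs => ⟨hs.1, hs.2.trans (ENNReal.ofReal_le_ofReal hxy)⟩

theorem decRearr_aem {f : ℝ → ℝ} (hf : AEMeasurable f μ01) :
    AEMeasurable (decRearr f) (volume.restrict (Ioc 0 1)) :=
  aemeasurable_restrict_of_antitoneOn measurableSet_Ioc (decRearr_anti hf)

theorem lt_of_lt_decRearr {f : ℝ → ℝ} {u s : ℝ} (hu : 0 ≤ u) (h : u < decRearr f s) :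
    ENNReal.ofReal s < μ01 {x | u < |f x|} := by
  by_contra! hc
  exact absurd h (not_lt.2 (csInf_le ⟨0, fun _ hx => hx.1⟩ ⟨hu, hc⟩))

theorem le_decRearr_of_lt {f : ℝ → ℝ} (hf : AEMeasurable f μ01) {u s : ℝ} (hs : 0 < s)
    (h : ENNReal.ofReal s < μ01 {x | u < |f x|}) : u ≤ decRearr f s := by
  refine le_csInf (rearr_nonempty hf hs) fun v hv => ?_
  by_contra! hc
  exact absurd (h.trans_le (measure_mono fun x hx => hc.trans hx)) (not_lt.2 hv.2)

theorem rearr_K {f : ℝ → ℝ} (hf : AEMeasurable f μ01) {a c : ℝ} (ha : a ≤ 1) (hc : 0 ≤ c) :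
    ∫⁻ s in Ioc 0 a, ENNReal.ofReal (decRearr f s) ≤
      ENNReal.ofReal c * ENNReal.ofReal a + ∫⁻ x, ENNReal.ofReal (|f x| - c) ∂μ01 := by
  have hsub : Ioc 0 a ⊆ Ioc (0:ℝ) 1 := Ioc_subset_Ioc_right ha
  calc ∫⁻ s in Ioc 0 a, ENNReal.ofReal (decRearr f s)
      ≤ ∫⁻ s in Ioc 0 a, (ENNReal.ofReal c + ENNReal.ofReal (max (decRearr f s - c) 0)) := by
        refine lintegral_mono fun s => ?_
        rw [← ENNReal.ofReal_add hc (le_max_right _ _)]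
        exact ENNReal.ofReal_le_ofReal (by linarith [le_max_left (decRearr f s - c) 0])
    _ = ENNReal.ofReal c * ENNReal.ofReal a
        + ∫⁻ s in Ioc 0 a, ENNReal.ofReal (max (decRearr f s - c) 0) := by
        rw [lintegral_add_left measurable_const]
        simp
    _ ≤ ENNReal.ofReal c * ENNReal.ofReal a
        + ∫⁻ s in Ioc 0 1, ENNReal.ofReal (max (decRearr f s - c) 0) := by
        gcongr
    _ ≤ ENNReal.ofReal c * ENNReal.ofReal a + ∫⁻ x, ENNReal.ofReal (max (|f x| - c) 0) ∂μ01 := by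
        gcongr 1
        rw [lintegral_eq_lintegral_meas_lt (f := fun s => max (decRearr f s - c) 0) _
            (ae_of_all _ fun s => le_max_right _ _)
            (((decRearr_aem hf).sub_const c).max aemeasurable_const),
          lintegral_eq_lintegral_meas_lt (f := fun x => max (|f x| - c) 0) _
            (ae_of_all _ fun s => le_max_right _ _)
            ((hf.abs.sub_const c).max aemeasurable_const)]
        refine setLIntegral_mono' measurableSet_Ioi fun u hu => ?_
        have hu : 0 < u := hu
        rw [Measure.restrict_apply' measurableSet_Ioc]
        have e : {x | u < max (|f x| - c) 0} = {x | u + c < |f x|} := by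
          ext x
          simp only [mem_ofPred_eq, lt_max_iff, not_lt.2 hu.le, or_false, lt_sub_iff_add_lt]
        rw [e]
        calc _ ≤ volume (Ioc 0 (μ01 {x | u + c < |f x|}).toReal) := by
              refine measure_mono ?_
              rintro s ⟨hs, hs1⟩
              refine ⟨hs1.1, ?_⟩
              simp only [mem_ofPred_eq, lt_max_iff, not_lt.2 hu.le, or_false,
                lt_sub_iff_add_lt] at hs
              have := lt_of_lt_decRearr (by positivity) hs
              exact (ENNReal.ofReal_le_iff_le_toReal (measure_ne_top _ _)).1 this.le
          _ = _ := by
              rw [Real.volume_Ioc, sub_zero, ENNReal.ofReal_toReal (measure_ne_top _ _)]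
    _ = _ := by
        congr 2
        ext x
        rw [ENNReal.ofReal_max]; simp

theorem rearr_sum {f : ℝ → ℝ} (hf : AEMeasurable f μ01) {g : ℕ → ℝ → ℝ} (hg : Admissible f g)
    {a : ℝ} (ha : a ∈ Icc (0:ℝ) 1) :
    ∫⁻ s in Ioc 0 a, ENNReal.ofReal (decRearr f s) ≤
      ∑' n, min (ENNReal.ofReal a * eLpNorm (g n) ⊤ μ01) (eLpNorm (g n) 1 μ01) := by
  classical
  rcases eq_or_lt_of_le ha.1 with h0 | h0
  · subst h0; simp
  obtain ⟨hgm, -, hg0, hfg⟩ := hg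
  set N : Set ℕ := {n | ENNReal.ofReal a * eLpNorm (g n) ⊤ μ01 ≤ eLpNorm (g n) 1 μ01} with hN
  set C : ℝ≥0∞ := ∑' n, if n ∈ N then eLpNorm (g n) ⊤ μ01 else 0 with hC
  set R : ℝ≥0∞ := ∑' n, if n ∈ N then 0 else eLpNorm (g n) 1 μ01 with hR
  have hsplit : ∑' n, min (ENNReal.ofReal a * eLpNorm (g n) ⊤ μ01) (eLpNorm (g n) 1 μ01)
      = C * ENNReal.ofReal a + R := by
    rw [mul_comm, hC, hR, ← ENNReal.tsum_mul_left, ← ENNReal.tsum_add]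
    congr 1; ext n
    by_cases h : n ∈ N
    · simp only [h, if_true, add_zero]; exact min_eq_left h
    · simp only [h, if_false, mul_zero, zero_add]; exact min_eq_right (not_le.1 h).le
  rw [hsplit]
  by_cases hCt : C = ⊤
  · rw [hCt, ENNReal.top_mul (ENNReal.ofReal_pos.2 h0).ne']; simp
  refine (rearr_K hf ha.2 (c := C.toReal) ENNReal.toReal_nonneg).trans ?_
  rw [ENNReal.ofReal_toReal hCt]
  gcongr 1
  have hb : ∀ᵐ x ∂μ01, ∀ n, ENNReal.ofReal (g n x) ≤ eLpNorm (g n) ⊤ μ01 := by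
    rw [ae_all_iff]; intro n
    filter_upwards [ae_le_eLpNormEssSup (f := g n) (μ := μ01)] with x hx
    rwa [Real.enorm_eq_ofReal (hg0 n x)] at hx
  calc ∫⁻ x, ENNReal.ofReal (|f x| - C.toReal) ∂μ01
      ≤ ∫⁻ x, ∑' n, (if n ∈ N then 0 else ENNReal.ofReal (g n x)) ∂μ01 := by
        refine lintegral_mono_ae ?_
        filter_upwards [hb, hfg] with x hx hfx
        rw [ENNReal.ofReal_sub _ ENNReal.toReal_nonneg, ENNReal.ofReal_toReal hCt,
          tsub_le_iff_left]
        refine hfx.trans ?_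
        rw [hC, ← ENNReal.tsum_add]
        refine ENNReal.tsum_le_tsum fun n => ?_
        by_cases h : n ∈ N
        · simpa [h] using hx n
        · simp [h]
    _ = ∑' n, ∫⁻ x, (if n ∈ N then 0 else ENNReal.ofReal (g n x)) ∂μ01 := by
        refine lintegral_tsum fun n => ?_
        by_cases h : n ∈ N
        · simp [h]
        · simpa [h] using (hgm n).ennreal_ofReal
    _ = R := by
        rw [hR]; congr 1; ext n
        by_cases h : n ∈ N
        · simp [h]
        · simp only [h, if_false, eLpNorm_one_eq_lintegral_enorm]
          congr 1; ext x; rw [Real.enorm_eq_ofReal (hg0 n x)]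

theorem lower_main {φ : ℝ → ℝ} (hφ : IsPhi φ) (hφ0 : Tendsto φ (𝓝[>] 0) (𝓝 0))
    {f : ℝ → ℝ} (hf : AEMeasurable f μ01) {g : ℕ → ℝ → ℝ} (hg : Admissible f g) :
    lorentzNorm φ f ≤ ∑' n, eLpNorm (g n) ⊤ μ01 *
      ENNReal.ofReal (φ ((eLpNorm (g n) 1 μ01 / eLpNorm (g n) ⊤ μ01).toReal)) := by
  rw [lorentz_eq hφ hφ0]
  set r : ℕ → ℝ := fun n => (eLpNorm (g n) 1 μ01 / eLpNorm (g n) ⊤ μ01).toReal with hr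
  have hle : ∀ n, eLpNorm (g n) 1 μ01 ≤ eLpNorm (g n) ⊤ μ01 := fun n =>
    eLpNorm_le_eLpNorm_of_exponent_le le_top (hg.1 n).aestronglyMeasurable
  have hdiv : ∀ n, eLpNorm (g n) 1 μ01 / eLpNorm (g n) ⊤ μ01 ≤ 1 := fun n =>
    ENNReal.div_le_of_le_mul (by rw [one_mul]; exact hle n)
  have hr1 : ∀ n, r n ∈ Icc (0:ℝ) 1 := fun n =>
    ⟨ENNReal.toReal_nonneg, ENNReal.toReal_le_of_le_ofReal zero_le_one (by simpa using hdiv n)⟩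
  have hgr : ∀ n, eLpNorm (g n) 1 μ01 = eLpNorm (g n) ⊤ μ01 * ENNReal.ofReal (r n) := by
    intro n
    rw [hr]
    simp only
    rw [ENNReal.ofReal_toReal ((hdiv n).trans_lt one_lt_top).ne]
    by_cases h0 : eLpNorm (g n) ⊤ μ01 = 0
    · have := hle n
      rw [h0] at this ⊢
      simpa using this
    · rw [ENNReal.mul_div_cancel h0 (hg.2.1 n).ne]
  have hwm : Measurable (deriv φ) := measurable_deriv φ
  have hnn : ∀ r ≤ 1, 0 ≤ᵐ[volume.restrict (Ioc 0 r)] deriv φ := by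
    intro r hr
    filter_upwards [ae_restrict_of_ae (phi_ae_diff hφ), ae_restrict_mem measurableSet_Ioc]
      with x hx hm
    exact phi_deriv_nonneg hφ (hx ⟨hm.1, hm.2.trans hr⟩).1
  set h : ℝ → ℝ≥0∞ := fun s => ENNReal.ofReal (decRearr f s) with hh
  have hhm : AEMeasurable h (volume.restrict (Ioc 0 1)) := (decRearr_aem hf).ennreal_ofReal
  have e1 : ∫⁻ s in Ioc (0:ℝ) 1, h s * ENNReal.ofReal (deriv φ s)
      = ∫⁻ s, ENNReal.ofReal (deriv φ s) ∂((volume.restrict (Ioc (0:ℝ) 1)).withDensity h) := by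
    rw [lintegral_withDensity_eq_lintegral_mul₀ hhm hwm.ennreal_ofReal.aemeasurable]
    rfl
  have hmeas : ∀ u : ℝ, MeasurableSet {s | u < deriv φ s} := fun u =>
    measurableSet_lt measurable_const hwm
  rw [e1, lintegral_eq_lintegral_meas_lt _
    ((withDensity_absolutelyContinuous _ _).ae_le (hnn 1 le_rfl)) hwm.aemeasurable]
  calc ∫⁻ u in Ioi (0:ℝ), (volume.restrict (Ioc (0:ℝ) 1)).withDensity h {s | u < deriv φ s}
      ≤ ∫⁻ u in Ioi (0:ℝ), ∑' n, eLpNorm (g n) ⊤ μ01 *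
          (volume.restrict (Ioc 0 (r n))) {s | u < deriv φ s} := by
        refine lintegral_mono fun u => ?_
        obtain ⟨a, ha, hae⟩ := phi_level hφ u
        rw [withDensity_apply _ (hmeas u), Measure.restrict_restrict (hmeas u),
          setLIntegral_congr hae]
        refine (rearr_sum hf hg ha).trans (ENNReal.tsum_le_tsum fun n => ?_)
        rw [hgr n, mul_comm, ← mul_min, Measure.restrict_apply (hmeas u)]
        gcongr 1
        have : ({s | u < deriv φ s} ∩ Ioc 0 (r n) : Set ℝ) =ᵐ[volume]
            (Ioc 0 a ∩ Ioc 0 (r n) : Set ℝ) := by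
          have e : ({s | u < deriv φ s} ∩ Ioc 0 (r n) : Set ℝ)
              = ({s | u < deriv φ s} ∩ Ioc 0 1) ∩ Ioc 0 (r n) := by
            rw [inter_assoc, inter_eq_right.2 (Ioc_subset_Ioc_right (hr1 n).2)]
          rw [e]
          exact hae.inter (ae_eq_refl _)
        rw [measure_congr this, Ioc_inter_Ioc, Real.volume_Ioc]
        simp
    _ = ∑' n, eLpNorm (g n) ⊤ μ01 * ∫⁻ u in Ioi (0:ℝ),
          (volume.restrict (Ioc 0 (r n))) {s | u < deriv φ s} := by
        have ham : ∀ n, Measurable fun u : ℝ =>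
            (volume.restrict (Ioc 0 (r n))) {s | u < deriv φ s} := fun n =>
          Antitone.measurable fun u v huv => measure_mono fun s hs => lt_of_le_of_lt huv hs
        rw [lintegral_tsum fun n => ((ham n).const_mul _).aemeasurable]
        congr 1; ext n
        rw [lintegral_const_mul _ (ham n)]
    _ = _ := by
        congr 1; ext n
        rw [← lintegral_eq_lintegral_meas_lt _ (hnn _ (hr1 n).2) hwm.aemeasurable,
          phi_lintegral hφ hφ0 (hr1 n)]

theorem lorentz_ge {φ : ℝ → ℝ} (hφ : IsPhi φ) (hφ0 : Tendsto φ (𝓝[>] 0) (𝓝 0))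
    {f : ℝ → ℝ} (hf : AEMeasurable f μ01) :
    ∑' k : ℤ, ENNReal.ofReal ((2:ℝ) ^ k) *
      ENNReal.ofReal (φ (μ01 {x | (2:ℝ) ^ (k + 1) < |f x|}).toReal) ≤ lorentzNorm φ f := by
  rw [lorentz_eq hφ hφ0]
  have hwm : Measurable (fun s => ENNReal.ofReal (deriv φ s)) :=
    (measurable_deriv φ).ennreal_ofReal
  set ν : Measure ℝ := (volume.restrict (Ioc (0:ℝ) 1)).withDensity
    (fun s => ENNReal.ofReal (deriv φ s)) with hν
  have hac : ν ≪ volume.restrict (Ioc (0:ℝ) 1) := withDensity_absolutelyContinuous _ _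
  have e1 : ∫⁻ s in Ioc (0:ℝ) 1, ENNReal.ofReal (decRearr f s) * ENNReal.ofReal (deriv φ s)
      = ∫⁻ s, ENNReal.ofReal (decRearr f s) ∂ν := by
    rw [hν, lintegral_withDensity_eq_lintegral_mul₀ hwm.aemeasurable
      (decRearr_aem hf).ennreal_ofReal]
    congr 1; ext s
    exact mul_comm _ _
  rw [e1, lintegral_eq_lintegral_meas_lt _ (ae_of_all _ (decRearr_nonneg f))
    ((decRearr_aem hf).mono_ac hac)]
  have hmono : Monotone fun k : ℤ => (2:ℝ) ^ k := zpow_right_mono₀ one_le_two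
  have hdisj : Pairwise (Function.onFun Disjoint fun k : ℤ => Ico ((2:ℝ) ^ k) (2 ^ (k + 1))) :=
    hmono.pairwise_disjoint_on_Ico_succ
  have hsub : (⋃ k : ℤ, Ico ((2:ℝ) ^ k) (2 ^ (k + 1))) ⊆ Ioi 0 := by
    refine iUnion_subset fun k x hx => ?_
    exact lt_of_lt_of_le (by positivity) hx.1
  refine le_trans ?_ (lintegral_mono_set hsub)
  rw [lintegral_iUnion (fun k => measurableSet_Ico) hdisj]
  refine ENNReal.tsum_le_tsum fun k => ?_
  set m : ℝ := (μ01 {x | (2:ℝ) ^ (k + 1) < |f x|}).toReal with hm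
  have hm1 : m ∈ Icc (0:ℝ) 1 :=
    ⟨ENNReal.toReal_nonneg, ENNReal.toReal_le_of_le_ofReal zero_le_one (by simpa using prob_le_one)⟩
  have hνm : ν (Ioo 0 m) = ENNReal.ofReal (φ m) := by
    rw [hν, withDensity_apply _ measurableSet_Ioo, Measure.restrict_restrict measurableSet_Ioo,
      inter_eq_left.2 (show Ioo 0 m ⊆ Ioc 0 1 from
        fun x hx => ⟨hx.1, hx.2.le.trans hm1.2⟩), setLIntegral_congr Ioo_ae_eq_Ioc,
      phi_lintegral hφ hφ0 hm1]
  calc ENNReal.ofReal ((2:ℝ) ^ k) * ENNReal.ofReal (φ m)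
      = ∫⁻ u in Ico ((2:ℝ) ^ k) (2 ^ (k + 1)), ENNReal.ofReal (φ m) := by
        rw [setLIntegral_const, Real.volume_Ico, mul_comm]
        congr 2
        rw [zpow_add_one₀ two_ne_zero]; ring
    _ ≤ _ := by
        refine setLIntegral_mono' measurableSet_Ico fun u hu => ?_
        rw [← hνm]
        refine measure_mono fun s hs => ?_
        refine lt_of_lt_of_le hu.2 (le_decRearr_of_lt hf hs.1 ?_)
        exact (ENNReal.ofReal_lt_iff_lt_toReal hs.1.le (measure_ne_top _ _)).2 hs.2

theorem upper_main {φ ψ : ℝ → ℝ} (hφ : IsPhi φ) (hφ0 : Tendsto φ (𝓝[>] 0) (𝓝 0))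
    {M : ℝ} (hM0 : 0 ≤ M) (hψ0 : ∀ n : ℕ, 0 ≤ ψ ((n:ℝ) + 1)) (hψ : ∀ n : ℕ, ψ ((n:ℝ) + 1) ≤ M)
    {f : ℝ → ℝ} (hf : AEMeasurable f μ01) :
    QANorm φ ψ f ≤ ENNReal.ofReal (4 * M) * lorentzNorm φ f := by
  set E : ℤ → Set ℝ := fun k => {x | (2:ℝ) ^ (k + 1) < |f x| ∧ |f x| ≤ (2:ℝ) ^ (k + 1 + 1)} with hE
  set G : ℤ → ℝ → ℝ := fun k => (E k).indicator fun _ => (2:ℝ) ^ (k + 1 + 1) with hG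
  have hEm : ∀ k, NullMeasurableSet (E k) μ01 := fun k =>
    (nullMeasurableSet_lt aemeasurable_const hf.abs).inter
      (nullMeasurableSet_le hf.abs aemeasurable_const)
  set e : ℕ ≃ ℤ := Equiv.intEquivNat.symm with he
  have hadm : Admissible f (fun n => G (e n)) := by
    refine ⟨fun n => aemeasurable_const.indicator₀ (hEm _), fun n => ?_, fun n x => ?_,
      ae_of_all _ fun x => ?_⟩
    · exact (eLpNormEssSup_indicator_const_le _ _).trans_lt enorm_lt_top
    · exact indicator_nonneg (fun _ _ => by positivity) x
    · rw [e.tsum_eq (fun k => ENNReal.ofReal (G k x))]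
      rcases eq_or_lt_of_le (abs_nonneg (f x)) with h | h
      · simp [← h]
      · obtain ⟨k, hk⟩ := exists_mem_Ioc_zpow h one_lt_two
        have hx : x ∈ E (k - 1) := by
          simp only [hE, mem_ofPred_eq, sub_add_cancel]; exact hk
        refine le_trans ?_ (ENNReal.le_tsum (k - 1))
        simp only [hG]
        rw [indicator_of_mem hx]
        exact ENNReal.ofReal_le_ofReal hx.2
  refine (iInf₂_le _ hadm).trans ?_
  refine le_trans ?_ (mul_le_mul_right (lorentz_ge hφ hφ0 hf) _)
  rw [← ENNReal.tsum_mul_left, ← e.tsum_eq]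
  refine ENNReal.tsum_le_tsum fun n => ?_
  beta_reduce
  generalize e n = k
  have hmem : ∀ s : Set ℝ, (μ01 s).toReal ∈ Icc (0:ℝ) 1 := fun s =>
    ⟨ENNReal.toReal_nonneg, ENNReal.toReal_le_of_le_ofReal zero_le_one (by simpa using prob_le_one)⟩
  have hφnn : ∀ t ∈ Icc (0:ℝ) 1, 0 ≤ φ t := fun t ht => by
    have := hφ.mono (by simp) ht ht.1
    rwa [hφ.zero] at this
  have h2 : (0:ℝ) < 2 ^ k := by positivity
  have h4 : (2:ℝ) ^ (k + 1 + 1) = 4 * 2 ^ k := by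
    rw [zpow_add_one₀ two_ne_zero, zpow_add_one₀ two_ne_zero]; ring
  rw [← ENNReal.ofReal_mul h2.le, ← ENNReal.ofReal_mul (by positivity)]
  refine ENNReal.ofReal_le_ofReal ?_
  have hmm := hφnn _ (hmem {x | (2:ℝ) ^ (k + 1) < |f x|})
  by_cases h0 : μ01 (E k) = 0
  · have : eLpNorm (G k) ⊤ μ01 = 0 := by
      rw [eLpNorm_eq_zero_iff (aemeasurable_const.indicator₀ (hEm _)).aestronglyMeasurable
        (by simp)]
      exact indicator_meas_zero h0
    rw [this]
    simp only [ENNReal.toReal_zero, mul_zero, zero_mul]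
    positivity
  · have htop : eLpNorm (G k) ⊤ μ01 = ENNReal.ofReal (2 ^ (k + 1 + 1)) := by
      rw [eLpNorm_exponent_top, eLpNormEssSup_indicator_const_eq _ _ h0,
        Real.enorm_eq_ofReal (by positivity)]
    have hone : eLpNorm (G k) 1 μ01 = ENNReal.ofReal (2 ^ (k + 1 + 1)) * μ01 (E k) := by
      rw [eLpNorm_indicator_const₀ (hEm k) one_ne_zero one_ne_top,
        Real.enorm_eq_ofReal (by positivity)]
      simp
    have hp : (0:ℝ) < 2 ^ (k + 1 + 1) := by positivity
    rw [hone, htop, mul_comm _ (μ01 (E k)), ENNReal.mul_div_cancel_right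
      (ENNReal.ofReal_pos.2 hp).ne' ENNReal.ofReal_ne_top, ENNReal.toReal_ofReal hp.le, h4]
    have hle : φ (μ01 (E k)).toReal ≤ φ (μ01 {x | (2:ℝ) ^ (k + 1) < |f x|}).toReal :=
      hφ.mono (hmem _) (hmem _) (ENNReal.toReal_mono (measure_ne_top _ _)
        (measure_mono fun x hx => hx.1))
    calc ψ ((n:ℝ) + 1) * (4 * 2 ^ k) * φ (μ01 (E k)).toReal
        ≤ M * (4 * 2 ^ k) * φ (μ01 {x | (2:ℝ) ^ (k + 1) < |f x|}).toReal := by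
          have := hψ n
          have := hφnn _ (hmem (E k))
          gcongr
      _ = _ := by ring

/-- if `ψ` is bounded on `[1,∞)` then `QA_{φ,ψ} = Λ_φ` with equivalent
(quasi-)norms. -/
theorem stmt15 {φ ψ : ℝ → ℝ} (hφ : IsPhi φ) (hψ : IsPsi ψ)
    (hφ0 : Tendsto φ (𝓝[>] 0) (𝓝 0))
    (hφslope : Tendsto (fun t => φ t / t) (𝓝[>] 0) atTop)
    (hbdd : ∃ M : ℝ, ∀ t : ℝ, 1 ≤ t → ψ t ≤ M) :
    ∃ K : ℝ, 0 < K ∧ ∀ f : ℝ → ℝ, AEMeasurable f μ01 →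
      ENNReal.ofReal K⁻¹ * lorentzNorm φ f ≤ QANorm φ ψ f ∧
      QANorm φ ψ f ≤ ENNReal.ofReal K * lorentzNorm φ f := by
  obtain ⟨M, hM⟩ := hbdd
  have h1 : 0 < ψ 1 := hψ.pos 1 one_pos
  have hMpos : 0 < M := h1.trans_le (hM 1 le_rfl)
  have hlow : ∀ n : ℕ, ψ 1 ≤ ψ ((n:ℝ) + 1) := fun n =>
    hψ.mono (by simp) (by simp only [mem_Ici]; positivity) (by simp)
  have hK : 0 < max (ψ 1)⁻¹ (4 * M) := lt_max_of_lt_left (inv_pos.2 h1)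
  refine ⟨max (ψ 1)⁻¹ (4 * M), hK, fun f hf => ⟨?_, ?_⟩⟩
  · refine le_iInf₂ fun g hg => ?_
    refine (mul_le_mul_right (lower_main hφ hφ0 hf hg) _).trans ?_
    rw [← ENNReal.tsum_mul_left]
    refine ENNReal.tsum_le_tsum fun n => ?_
    have h2 : (max (ψ 1)⁻¹ (4 * M))⁻¹ ≤ ψ ((n:ℝ) + 1) :=
      (inv_le_of_inv_le₀ h1 (le_max_left _ _)).trans (hlow n)
    have h3 : 0 ≤ ψ ((n:ℝ) + 1) := h1.le.trans (hlow n)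
    rw [mul_assoc, ENNReal.ofReal_mul h3, ENNReal.ofReal_mul ENNReal.toReal_nonneg,
      ENNReal.ofReal_toReal (hg.2.1 n).ne]
    gcongr
  · refine (upper_main hφ hφ0 (ψ := ψ) (M := M) hMpos.le
      (fun n => h1.le.trans (hlow n)) (fun n => hM _ (by simp)) hf).trans ?_
    gcongr
    exact le_max_right _ _
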